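/- arXiv:1303.1284 — 3 statements merged into one kernel-verified Lean document; each statement's English description precedes it below -/
import Mathlib

section
/- Let Z⁽¹⁾, Z⁽²⁾, … be a sequence of mutually independent generators on ℝ^d (on a common probability space), and set f_n(x) := E(max_{1≤i≤d} |x_i| ∏_{m=1}^n Z⁽ᵐ⁾_i) for x ∈ ℝ^d and n ∈ ℕ. Then for each x ∈ ℝ^d the sequence (f_n(x))_{n∈ℕ} is nondecreasing and bounded above by Σ_{i=1}^d |x_i|, so the limit f(x) := lim_{n→∞} f_n(x) exists; moreover f is a norm on ℝ^d satisfying max_{1≤i≤d} |x_i| ≤ f(x) ≤ Σ_{i=1}^d |x_i| for all x ∈ ℝ^d. -/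
open MeasureTheory ProbabilityTheory Filter

theorem integrable_iSup_of_finite {ι Ω : Type*} [Fintype ι] [Nonempty ι] [MeasurableSpace Ω]
    {μ : Measure Ω} {g : ι → Ω → ℝ} (hg : ∀ i, Integrable (g i) μ) :
    Integrable (fun ω => ⨆ i, g i ω) μ := by
  refine (integrable_finsetSum Finset.univ fun i _ => (hg i).abs).mono'
    (AEMeasurable.iSup fun i => (hg i).aemeasurable).aestronglyMeasurable (ae_of_all _ fun ω => ?_)
  obtain ⟨i, hi⟩ := exists_eq_ciSup_of_finite (f := fun i => g i ω)
  rw [Real.norm_eq_abs, ← hi]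
  exact Finset.single_le_sum (f := fun i => |g i ω|) (fun i _ => abs_nonneg _) (Finset.mem_univ i)

theorem integral_iSup_le_integral_iSup_mul_of_indepFun {ι Ω : Type*} [Fintype ι] [Nonempty ι]
    [MeasurableSpace Ω] {μ : Measure Ω} [IsProbabilityMeasure μ] {X Y : Ω → ι → ℝ}
    (hX : Measurable X) (hY : Measurable Y) (hXi : ∀ i, Integrable (fun ω => X ω i) μ)
    (hYi : ∀ i, Integrable (fun ω => Y ω i) μ) (hY1 : ∀ i, ∫ ω, Y ω i ∂μ = 1)
    (hXY : IndepFun X Y μ) (a : ι → ℝ) :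
    ∫ ω, ⨆ i, a i * X ω i ∂μ ≤ ∫ ω, ⨆ i, a i * (X ω i * Y ω i) ∂μ := by
  have hmap := (indepFun_iff_map_prod_eq_prod_map_map hX.aemeasurable hY.aemeasurable).1 hXY
  have := Measure.isProbabilityMeasure_map (μ := μ) hX.aemeasurable
  have := Measure.isProbabilityMeasure_map (μ := μ) hY.aemeasurable
  have hXYi (i : ι) : Integrable (fun ω => X ω i * Y ω i) μ :=
    (hXY.comp (measurable_pi_apply i) (measurable_pi_apply i)).integrable_mul (hXi i) (hYi i)
  have hG : Measurable fun p : (ι → ℝ) × (ι → ℝ) => ⨆ i, a i * (p.1 i * p.2 i) :=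
    Measurable.iSup fun i => by fun_prop
  have hg : Measurable fun p : ι → ℝ => ⨆ i, a i * p i := Measurable.iSup fun i => by fun_prop
  have hGi : Integrable (fun p : (ι → ℝ) × (ι → ℝ) => ⨆ i, a i * (p.1 i * p.2 i))
      ((μ.map X).prod (μ.map Y)) := by
    rw [← hmap, integrable_map_measure hG.aestronglyMeasurable (by fun_prop)]
    exact integrable_iSup_of_finite fun i => (hXYi i).const_mul (a i)
  have hgi : Integrable (fun p : ι → ℝ => ⨆ i, a i * p i) (μ.map X) := by
    rw [integrable_map_measure hg.aestronglyMeasurable (by fun_prop)]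
    exact integrable_iSup_of_finite fun i => (hXi i).const_mul (a i)
  have hcoord (i : ι) : Integrable (fun y : ι → ℝ => y i) (μ.map Y) := by
    have hi : Measurable fun y : ι → ℝ => y i := measurable_pi_apply i
    exact (integrable_map_measure hi.aestronglyMeasurable hY.aemeasurable).2 (hYi i)
  have hmean (i : ι) : ∫ y, y i ∂μ.map Y = 1 := by
    have hi : Measurable fun y : ι → ℝ => y i := measurable_pi_apply i
    rw [integral_map hY.aemeasurable hi.aestronglyMeasurable, hY1 i]
  calc ∫ ω, ⨆ i, a i * X ω i ∂μ = ∫ x, ⨆ i, a i * x i ∂μ.map X :=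
        (integral_map hX.aemeasurable hg.aestronglyMeasurable).symm
    _ ≤ ∫ x, ∫ y, ⨆ i, a i * (x i * y i) ∂μ.map Y ∂μ.map X := by
        refine integral_mono hgi hGi.integral_prod_left fun x => ciSup_le fun i => ?_
        have hi (j : ι) : Integrable (fun y : ι → ℝ => a j * (x j * y j)) (μ.map Y) :=
          ((hcoord j).const_mul _).const_mul _
        calc a i * x i = ∫ y, a i * (x i * y i) ∂μ.map Y := by
              rw [integral_const_mul, integral_const_mul, hmean i, mul_one]
          _ ≤ _ := integral_mono (hi i) (integrable_iSup_of_finite hi) fun y =>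
              le_ciSup (f := fun j => a j * (x j * y j)) (Set.finite_range _).bddAbove i
    _ = ∫ p, ⨆ i, a i * (p.1 i * p.2 i) ∂(μ.map X).prod (μ.map Y) := (integral_prod _ hGi).symm
    _ = _ := by
        rw [← hmap, integral_map (by fun_prop) hG.aestronglyMeasurable]

theorem integrable_prod_range_and_integral_eq_one {ι Ω : Type*} [MeasurableSpace Ω]
    {μ : Measure Ω} [IsProbabilityMeasure μ] {Z : ℕ → Ω → ι → ℝ} (hZm : ∀ n, Measurable (Z n))
    (hZint : ∀ n i, Integrable (fun ω => Z n ω i) μ) (hZmean : ∀ n i, ∫ ω, Z n ω i ∂μ = 1)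
    (hindep : iIndepFun Z μ) (i : ι) (n : ℕ) :
    Integrable (fun ω => ∏ m ∈ Finset.range n, Z m ω i) μ ∧
      ∫ ω, ∏ m ∈ Finset.range n, Z m ω i ∂μ = 1 := by
  induction n with
  | zero => simp
  | succ n ih =>
    have hind : IndepFun (fun ω => ∏ m ∈ Finset.range n, Z m ω i) (fun ω => Z n ω i) μ := by
      convert (hindep.indepFun_prod_range_succ hZm n).comp (measurable_pi_apply i)
        (measurable_pi_apply i) using 1
      · ext ω
        simp
      · rfl
    simp only [Finset.prod_range_succ]
    refine ⟨hind.integrable_mul ih.1 (hZint n i), ?_⟩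
    rw [hind.integral_fun_mul_eq_mul_integral ih.1.aestronglyMeasurable
      (hZint n i).aestronglyMeasurable, ih.2, hZmean, one_mul]

/-- The track of D-norms of a sequence of mutually independent generators is
nondecreasing, bounded by the L¹-norm, and converges to a D-norm-like norm. -/
theorem track_limit_exists_and_is_norm {d : ℕ} (hd : 0 < d)
    {Ω : Type*} [MeasurableSpace Ω] (μ : Measure Ω) [IsProbabilityMeasure μ]
    (Z : ℕ → Ω → Fin d → ℝ) (hZm : ∀ n, Measurable (Z n))
    (hZnn : ∀ n i, ∀ᵐ ω ∂μ, 0 ≤ Z n ω i)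
    (hZint : ∀ n i, Integrable (fun ω => Z n ω i) μ)
    (hZmean : ∀ n i, ∫ ω, Z n ω i ∂μ = 1)
    (hindep : iIndepFun Z μ) :
    (∀ x : Fin d → ℝ,
      Monotone fun n => ∫ ω, ⨆ i, |x i| * ∏ m ∈ Finset.range n, Z m ω i ∂μ) ∧
    (∀ (x : Fin d → ℝ) (n : ℕ),
      (∫ ω, ⨆ i, |x i| * ∏ m ∈ Finset.range n, Z m ω i ∂μ) ≤ ∑ i, |x i|) ∧
    ∃ F : (Fin d → ℝ) → ℝ,
      (∀ x : Fin d → ℝ,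
        Tendsto (fun n => ∫ ω, ⨆ i, |x i| * ∏ m ∈ Finset.range n, Z m ω i ∂μ)
          atTop (nhds (F x))) ∧
      (∀ x y : Fin d → ℝ, F (x + y) ≤ F x + F y) ∧
      (∀ (c : ℝ) (x : Fin d → ℝ), F (c • x) = |c| * F x) ∧
      (∀ x : Fin d → ℝ, F x = 0 ↔ x = 0) ∧
      (∀ x : Fin d → ℝ, (⨆ i, |x i|) ≤ F x ∧ F x ≤ ∑ i, |x i|) := by
  have : Nonempty (Fin d) := ⟨⟨0, hd⟩⟩
  set P : ℕ → Ω → Fin d → ℝ := fun n ω i => ∏ m ∈ Finset.range n, Z m ω i with hP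
  have hPi (n : ℕ) (i : Fin d) : Integrable (fun ω => P n ω i) μ :=
    (integrable_prod_range_and_integral_eq_one hZm hZint hZmean hindep i n).1
  have hP1 (n : ℕ) (i : Fin d) : ∫ ω, P n ω i ∂μ = 1 :=
    (integrable_prod_range_and_integral_eq_one hZm hZint hZmean hindep i n).2
  have hP0 (n : ℕ) : ∀ᵐ ω ∂μ, ∀ i, 0 ≤ P n ω i := by
    filter_upwards [ae_all_iff.2 fun m => ae_all_iff.2 (hZnn m)] with ω h i
    exact Finset.prod_nonneg fun m _ => h m i
  have hPm (n : ℕ) : Measurable (P n) := by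
    rw [measurable_pi_iff]
    exact fun i => Finset.measurable_fun_prod _ fun m _ => (measurable_pi_apply i).comp (hZm m)
  have hPZ (n : ℕ) : IndepFun (P n) (Z n) μ := by
    convert hindep.indepFun_prod_range_succ hZm n using 1
    ext ω i
    simp [hP]
  have hint (x : Fin d → ℝ) (n : ℕ) : Integrable (fun ω => ⨆ i, |x i| * P n ω i) μ :=
    integrable_iSup_of_finite fun i => (hPi n i).const_mul _
  have hbdd (x p : Fin d → ℝ) : BddAbove (Set.range fun i => |x i| * p i) :=
    (Set.finite_range _).bddAbove
  set f : (Fin d → ℝ) → ℕ → ℝ := fun x n => ∫ ω, ⨆ i, |x i| * P n ω i ∂μ with hf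
  have hmono (x : Fin d → ℝ) : Monotone (f x) := monotone_nat_of_le_succ fun n => by
    simpa only [hf, hP, Finset.prod_range_succ] using
      integral_iSup_le_integral_iSup_mul_of_indepFun (hPm n) (hZm n) (hPi n) (hZint n) (hZmean n)
        (hPZ n) fun i => |x i|
  have hle (x : Fin d → ℝ) (n : ℕ) : f x n ≤ ∑ i, |x i| := by
    calc f x n ≤ ∫ ω, ∑ i, |x i| * P n ω i ∂μ := by
          refine integral_mono_ae (hint x n)
            (integrable_finsetSum _ fun i _ => (hPi n i).const_mul _) ?_
          filter_upwards [hP0 n] with ω h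
          exact ciSup_le fun i => Finset.single_le_sum (f := fun i => |x i| * P n ω i)
            (fun j _ => mul_nonneg (abs_nonneg _) (h j)) (Finset.mem_univ i)
      _ = ∑ i, |x i| := by
          rw [integral_finsetSum _ fun i _ => (hPi n i).const_mul _]
          simp only [integral_const_mul, hP1, mul_one]
  have hlim (x : Fin d → ℝ) : Tendsto (f x) atTop (nhds (⨆ n, f x n)) :=
    tendsto_atTop_ciSup (hmono x) ⟨_, Set.forall_mem_range.2 (hle x)⟩
  have hlower (x : Fin d → ℝ) : (⨆ i, |x i|) ≤ ⨆ n, f x n := by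
    refine ge_of_tendsto' (hlim x) fun n => ?_
    simpa [hf, hP] using hmono x (Nat.zero_le n)
  have hsmul (c : ℝ) (x : Fin d → ℝ) (n : ℕ) : f (c • x) n = |c| * f x n := by
    simp only [hf, Pi.smul_apply, smul_eq_mul, abs_mul, mul_assoc, ← integral_const_mul,
      Real.mul_iSup_of_nonneg (abs_nonneg c)]
  have hadd (x y : Fin d → ℝ) (n : ℕ) : f (x + y) n ≤ f x n + f y n := by
    simp only [hf]
    rw [← integral_add (hint x n) (hint y n)]
    refine integral_mono_ae (hint _ n) ((hint x n).add (hint y n)) ?_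
    filter_upwards [hP0 n] with ω h
    refine ciSup_le fun i => ?_
    calc |(x + y) i| * P n ω i ≤ |x i| * P n ω i + |y i| * P n ω i := by
          rw [← add_mul]
          exact mul_le_mul_of_nonneg_right (abs_add_le _ _) (h i)
      _ ≤ _ := add_le_add (le_ciSup (hbdd x (P n ω)) i) (le_ciSup (hbdd y (P n ω)) i)
  refine ⟨hmono, hle, fun x => ⨆ n, f x n, hlim, fun x y => ?_, fun c x => ?_, fun x => ?_,
    fun x => ⟨hlower x, ciSup_le (hle x)⟩⟩
  · exact le_of_tendsto_of_tendsto' (hlim _) ((hlim x).add (hlim y)) (hadd x y)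
  · simp only [hsmul, Real.mul_iSup_of_nonneg (abs_nonneg c)]
  · refine ⟨fun h => funext fun i => ?_, fun h => ?_⟩
    · have hi : |x i| ≤ 0 :=
        (le_ciSup (f := fun i => |x i|) (Set.finite_range _).bddAbove i).trans
          ((hlower x).trans h.le)
      exact abs_nonpos_iff.1 hi
    · subst h
      simp [hf]
end

section
/- Let Z⁽¹⁾, Z⁽²⁾, … be mutually independent copies of a generator Z on ℝ^d, set f_n(x) := E(max_{1≤i≤d} |x_i| ∏_{m=1}^n Z⁽ᵐ⁾_i) and f(x) := lim_{n→∞} f_n(x) (which exists, f_n being nondecreasing in n and bounded by the L¹-norm). Then for every k ∈ ℕ and every x ∈ ℝ^d, f(x) = E( f( x · ∏_{m=1}^k Z⁽ᵐ⁾ ) ), where x · ∏_{m=1}^k Z⁽ᵐ⁾ denotes the componentwise product (x_1 ∏_{m=1}^k Z⁽ᵐ⁾_1, …, x_d ∏_{m=1}^k Z⁽ᵐ⁾_d). -/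
open MeasureTheory ProbabilityTheory Filter

section ProductsOfIndependentCopies

variable {Ω : Type*} [MeasurableSpace Ω] {μ : Measure Ω}

/-- A finite product of independent integrable variables of mean one is integrable of mean one. -/
lemma ProbabilityTheory.iIndepFun.integrable_and_integral_prod_range_eq_one
    [IsProbabilityMeasure μ] {W : ℕ → Ω → ℝ}
    (hW : iIndepFun W μ) (hm : ∀ n, Measurable (W n)) (hint : ∀ n, Integrable (W n) μ)
    (hmean : ∀ n, ∫ ω, W n ω ∂μ = 1) (n : ℕ) :
    Integrable (fun ω => ∏ m ∈ Finset.range n, W m ω) μ ∧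
      ∫ ω, ∏ m ∈ Finset.range n, W m ω ∂μ = 1 := by
  induction n with
  | zero => simp
  | succ n ih =>
    have hind : IndepFun (fun ω => ∏ m ∈ Finset.range n, W m ω) (W n) μ := by
      have h := hW.indepFun_finsetProd_of_notMem hm (Finset.notMem_range_self (n := n))
      have he : (∏ j ∈ Finset.range n, W j) = fun ω => ∏ m ∈ Finset.range n, W m ω := by
        ext ω; simp
      rwa [he] at h
    simp only [Finset.prod_range_succ]
    refine ⟨hind.integrable_mul ih.1 (hint n), ?_⟩
    rw [hind.integral_fun_mul_eq_mul_integral ih.1.aestronglyMeasurable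
      (hint n).aestronglyMeasurable, ih.2, hmean n, mul_one]

variable {E : Type*} [MeasurableSpace E] [CommMonoid E] [MeasurableMul₂ E] {X : ℕ → Ω → E}

lemma ProbabilityTheory.iIndepFun.indepFun_prod_range_prod_range_add (hX : iIndepFun X μ)
    (hm : ∀ n, Measurable (X n)) (k n : ℕ) :
    IndepFun (fun ω => ∏ m ∈ Finset.range k, X m ω)
      (fun ω => ∏ m ∈ Finset.range n, X (k + m) ω) μ := by
  have hdisj : Disjoint (Finset.range k) (Finset.Ico k (k + n)) := by
    rw [Finset.disjoint_left]
    intro a ha hb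
    simp only [Finset.mem_range, Finset.mem_Ico] at ha hb
    omega
  have h := (hX.indepFun_finset _ _ hdisj hm).comp
    (φ := fun y => ∏ m : Finset.range k, y m)
    (ψ := fun y => ∏ m : Finset.Ico k (k + n), y m)
    (Finset.measurable_fun_prod _ fun i _ => measurable_pi_apply i)
    (Finset.measurable_fun_prod _ fun i _ => measurable_pi_apply i)
  convert! h using 1
  · ext ω
    exact (Finset.prod_coe_sort (Finset.range k) fun m => X m ω).symm
  · ext ω
    refine Eq.trans ?_ (Finset.prod_coe_sort (Finset.Ico k (k + n)) fun m => X m ω).symm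
    rw [Finset.prod_Ico_eq_prod_range]
    simp

lemma ProbabilityTheory.iIndepFun.map_prod_range_add_eq (hX : iIndepFun X μ)
    (hm : ∀ n, Measurable (X n)) {ν : Measure E} (hν : ∀ n, μ.map (X n) = ν) (k n : ℕ) :
    μ.map (fun ω => ∏ m ∈ Finset.range n, X (k + m) ω) =
      μ.map (fun ω => ∏ m ∈ Finset.range n, X m ω) := by
  have hseq : μ.map (fun ω m => X (k + m) ω) = μ.map (fun ω m => X m ω) := by
    rw [(hX.precomp (add_right_injective k)).map_fun_eq_infinitePi_map fun m => hm (k + m),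
      hX.map_fun_eq_infinitePi_map hm]
    simp only [hν]
  have hφ : Measurable fun y : ℕ → E => ∏ m ∈ Finset.range n, y m :=
    Finset.measurable_fun_prod _ fun i _ => measurable_pi_apply i
  have h := congrArg (Measure.map fun y : ℕ → E => ∏ m ∈ Finset.range n, y m) hseq
  rwa [Measure.map_map hφ (measurable_pi_lambda _ fun m => hm (k + m)),
    Measure.map_map hφ (measurable_pi_lambda _ hm)] at h

end ProductsOfIndependentCopies

lemma abs_ciSup_le_sum_abs {ι : Type*} [Fintype ι] (a : ι → ℝ) : |⨆ i, a i| ≤ ∑ i, |a i| := by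
  cases isEmpty_or_nonempty ι
  · simp
  · obtain ⟨i, hi⟩ := exists_eq_ciSup_of_finite (f := a)
    rw [← hi]
    exact Finset.single_le_sum (f := fun j => |a j|) (fun j _ => abs_nonneg _) (Finset.mem_univ i)

/-- The limit `f` of the track of powers of a fixed D-norm satisfies
`f(x) = E(f(x · ∏_{m<k} Z⁽ᵐ⁾))` for every `k`. -/
theorem track_limit_self_consistency {d : ℕ} (hd : 0 < d)
    {Ω : Type*} [MeasurableSpace Ω] (μ : Measure Ω) [IsProbabilityMeasure μ]
    (Z : Ω → Fin d → ℝ) (hZm : Measurable Z)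
    (hZnn : ∀ i, ∀ᵐ ω ∂μ, 0 ≤ Z ω i)
    (hZint : ∀ i, Integrable (fun ω => Z ω i) μ)
    (hZmean : ∀ i, ∫ ω, Z ω i ∂μ = 1)
    (Zs : ℕ → Ω → Fin d → ℝ) (hZsm : ∀ n, Measurable (Zs n))
    (hindep : iIndepFun Zs μ)
    (hcopies : ∀ n, μ.map (Zs n) = μ.map Z)
    (F : (Fin d → ℝ) → ℝ)
    (hF : ∀ x : Fin d → ℝ,
      Tendsto (fun n => ∫ ω, ⨆ i, |x i| * ∏ m ∈ Finset.range n, Zs m ω i ∂μ)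
        atTop (nhds (F x))) :
    ∀ (k : ℕ) (x : Fin d → ℝ),
      F x = ∫ ω, F (fun i => x i * ∏ m ∈ Finset.range k, Zs m ω i) ∂μ := by
  intro k x
  set P : ℕ → Ω → Fin d → ℝ := fun n ω => ∏ m ∈ Finset.range n, Zs m ω with hP
  have hPi : ∀ n ω i, P n ω i = ∏ m ∈ Finset.range n, Zs m ω i := fun n ω i => by
    simp [hP, Finset.prod_apply]
  have hPm : ∀ n, Measurable (P n) := fun n =>
    Finset.measurable_fun_prod _ fun m _ => hZsm m
  have hident : ∀ n, IdentDistrib (Zs n) Z μ μ := fun n =>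
    ⟨(hZsm n).aemeasurable, hZm.aemeasurable, hcopies n⟩
  have hidenti : ∀ n i, IdentDistrib (fun ω => Zs n ω i) (fun ω => Z ω i) μ μ := fun n i =>
    (hident n).comp (measurable_pi_apply i)
  have hPnn : ∀ n i, ∀ᵐ ω ∂μ, 0 ≤ P n ω i := by
    intro n i
    have h : ∀ m, ∀ᵐ ω ∂μ, 0 ≤ Zs m ω i := fun m =>
      (hidenti m i).symm.ae_snd measurableSet_Ici (hZnn i)
    filter_upwards [ae_all_iff.2 h] with ω hω
    rw [hPi]
    exact Finset.prod_nonneg fun m _ => hω m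
  have hPint : ∀ n i, Integrable (fun ω => P n ω i) μ ∧ ∫ ω, P n ω i ∂μ = 1 := by
    intro n i
    simp only [hPi]
    exact (hindep.comp (fun _ y => y i) fun _ => measurable_pi_apply i
      ).integrable_and_integral_prod_range_eq_one
      (fun m => (measurable_pi_apply i).comp (hZsm m))
      (fun m => (hidenti m i).symm.integrable_snd (hZint i))
      (fun m => (hidenti m i).integral_eq.trans (hZmean i)) n
  have hPabs : ∀ n i, ∫ ω, |P n ω i| ∂μ = 1 := by
    intro n i
    rw [← (hPint n i).2]
    exact integral_congr_ae ((hPnn n i).mono fun ω hω => abs_of_nonneg hω)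
  set G : ℕ → (Fin d → ℝ) → ℝ := fun n y => ∫ ω, ⨆ i, |y i| * P n ω i ∂μ with hG
  have hFG : ∀ y, Tendsto (fun n => G n y) atTop (nhds (F y)) := by
    intro y
    simpa only [hG, hPi] using hF y
  have hGbound : ∀ n y, |G n y| ≤ ∑ i, |y i| := by
    intro n y
    calc |G n y| ≤ ∫ ω, ∑ i, |y i| * |P n ω i| ∂μ := by
          refine norm_integral_le_of_norm_le (f := fun ω => ⨆ i, |y i| * P n ω i)
            (integrable_finsetSum _ fun i _ => (hPint n i).1.abs.const_mul _)
            (Eventually.of_forall fun ω => ?_)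
          refine (abs_ciSup_le_sum_abs _).trans_eq ?_
          simp [abs_mul]
      _ = ∑ i, |y i| := by
          rw [integral_finsetSum _ fun i _ => (hPint n i).1.abs.const_mul _]
          simp [integral_const_mul, hPabs]
  have hsup : Measurable fun q : (Fin d → ℝ) × (Fin d → ℝ) => ⨆ i, |q.1 i| * q.2 i := by
    refine Measurable.iSup fun i => ?_
    fun_prop
  have hGmeas : ∀ n, Measurable (G n) := by
    intro n
    have : Measurable fun q : (Fin d → ℝ) × Ω => ⨆ i, |q.1 i| * P n q.2 i :=
      hsup.comp (measurable_fst.prodMk ((hPm n).comp measurable_snd))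
    exact (this.stronglyMeasurable.integral_prod_right').measurable
  have hscale : Measurable fun p : Fin d → ℝ => fun i => x i * p i := by fun_prop
  have hstep : ∀ n, G (k + n) x = ∫ ω, G n (fun i => x i * P k ω i) ∂μ := by
    intro n
    set R : Ω → Fin d → ℝ := fun ω => ∏ m ∈ Finset.range n, Zs (k + m) ω with hR
    have hRm : Measurable R := Finset.measurable_fun_prod _ fun m _ => hZsm _
    have hmul : ∀ ω, P (k + n) ω = P k ω * R ω := fun ω => Finset.prod_range_add _ _ _
    have hRlaw : μ.map R = μ.map (P n) := hindep.map_prod_range_add_eq hZsm hcopies k n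
    have hprod : μ.map (fun ω => (P k ω, R ω)) = (μ.map (P k)).prod (μ.map (P n)) := by
      rw [← hRlaw]
      exact (indepFun_iff_map_prod_eq_prod_map_map (hPm k).aemeasurable hRm.aemeasurable).1
        (hindep.indepFun_prod_range_prod_range_add hZsm k n)
    set H : (Fin d → ℝ) × (Fin d → ℝ) → ℝ := fun q => ⨆ i, |x i * q.1 i| * q.2 i with hH
    have hHm : Measurable H :=
      hsup.comp ((hscale.comp measurable_fst).prodMk measurable_snd)
    have hpair : Measurable fun ω => (P k ω, R ω) := (hPm k).prodMk hRm
    have hHint : Integrable H ((μ.map (P k)).prod (μ.map (P n))) := by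
      rw [← hprod, integrable_map_measure hHm.aestronglyMeasurable hpair.aemeasurable]
      refine Integrable.mono' (g := fun ω => ∑ i, |x i| * |P (k + n) ω i|)
        (integrable_finsetSum _ fun i _ => (hPint _ i).1.abs.const_mul _)
        (hHm.comp hpair).aestronglyMeasurable (Eventually.of_forall fun ω => ?_)
      refine (abs_ciSup_le_sum_abs _).trans_eq ?_
      simp [hmul, abs_mul, mul_assoc]
    have hleft : G (k + n) x = ∫ ω, H (P k ω, R ω) ∂μ := by
      refine integral_congr_ae ?_
      filter_upwards [ae_all_iff.2 (hPnn k)] with ω hω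
      simp only [hH, hmul, Pi.mul_apply, abs_mul, abs_of_nonneg (hω _), mul_assoc]
    have hright : ∀ p, ∫ r, H (p, r) ∂(μ.map (P n)) = G n (fun i => x i * p i) := fun p =>
      integral_map (hPm n).aemeasurable
        (hHm.comp measurable_prodMk_left).aestronglyMeasurable
    rw [hleft, ← integral_map hpair.aemeasurable hHm.aestronglyMeasurable, hprod,
      integral_prod _ hHint]
    simp only [hright]
    exact integral_map (hPm k).aemeasurable ((hGmeas n).comp hscale).aestronglyMeasurable
  have hlim : Tendsto (fun n => ∫ ω, G n (fun i => x i * P k ω i) ∂μ) atTop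
      (nhds (∫ ω, F (fun i => x i * P k ω i) ∂μ)) := by
    refine tendsto_integral_of_dominated_convergence (fun ω => ∑ i, |x i| * |P k ω i|)
      (fun n => ((hGmeas n).comp (hscale.comp (hPm k))).aestronglyMeasurable)
      (integrable_finsetSum _ fun i _ => (hPint _ i).1.abs.const_mul _)
      (fun n => Eventually.of_forall fun ω => ?_)
      (Eventually.of_forall fun ω => hFG _)
    simpa only [abs_mul, Real.norm_eq_abs] using hGbound n fun i => x i * P k ω i
  simp only [← hstep] at hlim
  simp only [← hPi]
  refine tendsto_nhds_unique ((hFG x).comp ?_) hlim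
  exact tendsto_atTop_mono (fun n => Nat.le_add_left n k) tendsto_id
end

section
/- The limit of the track of powers of a fixed D-norm is idempotent: let Z⁽¹⁾, Z⁽²⁾, … be mutually independent copies of a generator Z on ℝ^d, and let f(x) := lim_{n→∞} E(max_{1≤i≤d} |x_i| ∏_{m=1}^n Z⁽ᵐ⁾_i), which exists for every x ∈ ℝ^d. Suppose Z* and Z*' are independent identically distributed random vectors with nonnegative integrable components of mean 1, independent of the sequence (Z⁽ⁿ⁾)_{n∈ℕ}, such that E(max_{1≤i≤d} |x_i| Z*_i) = f(x) for all x ∈ ℝ^d (i.e. Z* is a generator of the limit norm). Then E(max_{1≤i≤d} |x_i| Z*_i Z*'_i) = f(x) for all x ∈ ℝ^d. -/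
open MeasureTheory ProbabilityTheory Filter

/-- The expectation of `h (x * Y)` for a random vector `Y` with law `ρ`. -/
noncomputable def mulAverage {d : ℕ} (ρ : Measure (Fin d → ℝ)) (h : (Fin d → ℝ) → ℝ)
    (x : Fin d → ℝ) : ℝ :=
  ∫ y, h (x * y) ∂ρ

/-- A probability law on `ℝ^d` whose coordinates have first absolute moment `1`. -/
structure IsGeneratorLaw {d : ℕ} (ρ : Measure (Fin d → ℝ)) : Prop where
  isProbabilityMeasure : IsProbabilityMeasure ρ
  integrable_abs : ∀ i, Integrable (fun y : Fin d → ℝ => |y i|) ρ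
  integral_abs : ∀ i, ∫ y, |y i| ∂ρ = 1

/-- A measurable function on `ℝ^d` dominated by the `ℓ¹`-norm. -/
structure IsSumDominated {d : ℕ} (h : (Fin d → ℝ) → ℝ) : Prop where
  measurable : Measurable h
  abs_le : ∀ x, |h x| ≤ ∑ i, |x i|

section

variable {d : ℕ} {ρ ν : Measure (Fin d → ℝ)} {h : (Fin d → ℝ) → ℝ}

lemma isSumDominated_iSup_abs : IsSumDominated (fun x : Fin d → ℝ => ⨆ i, |x i|) where
  measurable := Measurable.iSup fun i => (measurable_pi_apply i).abs
  abs_le x := by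
    rw [abs_of_nonneg (Real.iSup_nonneg fun i => abs_nonneg _)]
    exact Real.iSup_le
      (fun i => Finset.single_le_sum (fun j _ => abs_nonneg (x j)) (Finset.mem_univ i))
      (Finset.sum_nonneg fun j _ => abs_nonneg _)

lemma IsGeneratorLaw.integrable_sum (hρ : IsGeneratorLaw ρ) (x : Fin d → ℝ) :
    Integrable (fun y => ∑ i, |x i| * |y i|) ρ :=
  integrable_finsetSum _ fun i _ => (hρ.integrable_abs i).const_mul _

lemma IsSumDominated.abs_mul_le (hh : IsSumDominated h) (x y : Fin d → ℝ) :
    |h (x * y)| ≤ ∑ i, |x i| * |y i| := by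
  simpa [abs_mul] using hh.abs_le (x * y)

lemma IsSumDominated.integrable (hh : IsSumDominated h) (hρ : IsGeneratorLaw ρ)
    (x : Fin d → ℝ) : Integrable (fun y => h (x * y)) ρ :=
  (hρ.integrable_sum x).mono'
    (hh.measurable.comp (measurable_const.mul measurable_id)).aestronglyMeasurable
    (Eventually.of_forall fun y => hh.abs_mul_le x y)

lemma IsSumDominated.mulAverage (hh : IsSumDominated h) (hρ : IsGeneratorLaw ρ) :
    IsSumDominated (mulAverage ρ h) where
  measurable := by
    have := hρ.isProbabilityMeasure
    exact (StronglyMeasurable.integral_prod_right' (ν := ρ)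
      (f := fun p : (Fin d → ℝ) × (Fin d → ℝ) => h (p.1 * p.2))
      (hh.measurable.comp (measurable_fst.mul measurable_snd)).stronglyMeasurable).measurable
  abs_le x := by
    calc |∫ y, h (x * y) ∂ρ| ≤ ∫ y, |h (x * y)| ∂ρ := abs_integral_le_integral_abs
      _ ≤ ∫ y, ∑ i, |x i| * |y i| ∂ρ :=
        integral_mono (hh.integrable hρ x).abs (hρ.integrable_sum x) fun y => hh.abs_mul_le x y
      _ = ∑ i, |x i| := by
        rw [integral_finsetSum _ fun i _ => (hρ.integrable_abs i).const_mul _]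
        simp [integral_const_mul, hρ.integral_abs]

lemma IsSumDominated.integrable_prod (hh : IsSumDominated h) (hρ : IsGeneratorLaw ρ)
    (hν : IsGeneratorLaw ν) (x : Fin d → ℝ) :
    Integrable (fun p : (Fin d → ℝ) × (Fin d → ℝ) => h (x * p.1 * p.2)) (ρ.prod ν) := by
  have := hρ.isProbabilityMeasure
  have := hν.isProbabilityMeasure
  have hb : Integrable (fun p : (Fin d → ℝ) × (Fin d → ℝ) =>
      ∑ i, |x i| * (|p.1 i| * |p.2 i|)) (ρ.prod ν) :=
    integrable_finsetSum _ fun i _ =>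
      ((hρ.integrable_abs i).mul_prod (hν.integrable_abs i)).const_mul _
  refine hb.mono' (hh.measurable.comp
    ((measurable_const.mul measurable_fst).mul measurable_snd)).aestronglyMeasurable
    (Eventually.of_forall fun p => ?_)
  simpa [abs_mul, mul_assoc] using hh.abs_le (x * p.1 * p.2)

lemma IsSumDominated.mulAverage_comm (hh : IsSumDominated h) (hρ : IsGeneratorLaw ρ)
    (hν : IsGeneratorLaw ν) :
    _root_.mulAverage ρ (_root_.mulAverage ν h) = _root_.mulAverage ν (_root_.mulAverage ρ h) := by
  have := hρ.isProbabilityMeasure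
  have := hν.isProbabilityMeasure
  ext x
  simp only [_root_.mulAverage]
  rw [integral_integral_swap (f := fun y z => h (x * y * z)) (hh.integrable_prod hρ hν x)]
  simp only [mul_right_comm]

lemma tendsto_mulAverage {H : ℕ → (Fin d → ℝ) → ℝ} (hH : ∀ n, IsSumDominated (H n))
    (hlim : ∀ x, Tendsto (fun n => H n x) atTop (nhds (h x))) (hρ : IsGeneratorLaw ρ)
    (x : Fin d → ℝ) :
    Tendsto (fun n => mulAverage ρ (H n) x) atTop (nhds (mulAverage ρ h x)) :=
  tendsto_integral_of_dominated_convergence (fun y => ∑ i, |x i| * |y i|)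
    (fun n => ((hH n).integrable hρ x).aestronglyMeasurable) (hρ.integrable_sum x)
    (fun n => Eventually.of_forall fun y => (hH n).abs_mul_le x y)
    (Eventually.of_forall fun y => hlim (x * y))

variable {Ω : Type*} [MeasurableSpace Ω] {μ : Measure Ω} {X Y : Ω → Fin d → ℝ}

lemma mulAverage_map (hX : Measurable X) (hh : Measurable h) (x : Fin d → ℝ) :
    mulAverage (μ.map X) h x = ∫ ω, h (x * X ω) ∂μ :=
  integral_map hX.aemeasurable
    (hh.comp (measurable_const.mul measurable_id)).aestronglyMeasurable

lemma isGeneratorLaw_map [IsProbabilityMeasure μ] (hX : Measurable X)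
    (hnn : ∀ i, ∀ᵐ ω ∂μ, 0 ≤ X ω i) (hint : ∀ i, Integrable (fun ω => X ω i) μ)
    (hmean : ∀ i, ∫ ω, X ω i ∂μ = 1) : IsGeneratorLaw (μ.map X) where
  isProbabilityMeasure := Measure.isProbabilityMeasure_map hX.aemeasurable
  integrable_abs i :=
    (integrable_map_measure (measurable_pi_apply i).abs.aestronglyMeasurable
      hX.aemeasurable).2 (hint i).abs
  integral_abs i := by
    rw [integral_map hX.aemeasurable (measurable_pi_apply i).abs.aestronglyMeasurable, ← hmean i]
    exact integral_congr_ae ((hnn i).mono fun ω hω => abs_of_nonneg hω)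

lemma IsSumDominated.mulAverage_map_mul [IsProbabilityMeasure μ] (hh : IsSumDominated h)
    (hX : Measurable X) (hY : Measurable Y) (hXY : IndepFun X Y μ)
    (gX : IsGeneratorLaw (μ.map X)) (gY : IsGeneratorLaw (μ.map Y)) :
    _root_.mulAverage (μ.map (X * Y)) h =
      _root_.mulAverage (μ.map X) (_root_.mulAverage (μ.map Y) h) := by
  have := gX.isProbabilityMeasure
  have := gY.isProbabilityMeasure
  ext x
  rw [mulAverage_map (hX.mul hY) hh.measurable]
  simp only [_root_.mulAverage]
  rw [← integral_prod (fun p : (Fin d → ℝ) × (Fin d → ℝ) => h (x * p.1 * p.2))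
    (hh.integrable_prod gX gY x),
    ← (indepFun_iff_map_prod_eq_prod_map_map hX.aemeasurable hY.aemeasurable).1 hXY,
    integral_map (f := fun p : (Fin d → ℝ) × (Fin d → ℝ) => h (x * p.1 * p.2))
      (hX.prodMk hY).aemeasurable (hh.measurable.comp
      ((measurable_const.mul measurable_fst).mul measurable_snd)).aestronglyMeasurable]
  simp only [Pi.mul_apply, mul_assoc]

lemma isGeneratorLaw_map_mul [IsProbabilityMeasure μ]
    (hX : Measurable X) (hY : Measurable Y) (hXY : IndepFun X Y μ)
    (gX : IsGeneratorLaw (μ.map X)) (gY : IsGeneratorLaw (μ.map Y)) :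
    IsGeneratorLaw (μ.map (X * Y)) := by
  have habs (i : Fin d) : Measurable fun y : Fin d → ℝ => |y i| := (measurable_pi_apply i).abs
  have iX (i : Fin d) : Integrable (fun ω => |X ω i|) μ :=
    (integrable_map_measure (habs i).aestronglyMeasurable hX.aemeasurable).1 (gX.integrable_abs i)
  have iY (i : Fin d) : Integrable (fun ω => |Y ω i|) μ :=
    (integrable_map_measure (habs i).aestronglyMeasurable hY.aemeasurable).1 (gY.integrable_abs i)
  have hind (i : Fin d) : IndepFun (fun ω => |X ω i|) (fun ω => |Y ω i|) μ :=
    hXY.comp (habs i) (habs i)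
  refine ⟨Measure.isProbabilityMeasure_map (hX.mul hY).aemeasurable, fun i => ?_, fun i => ?_⟩
  · rw [integrable_map_measure (habs i).aestronglyMeasurable (hX.mul hY).aemeasurable]
    simpa [Function.comp_def, Pi.mul_def, abs_mul] using (hind i).integrable_mul (iX i) (iY i)
  · rw [integral_map (hX.mul hY).aemeasurable (habs i).aestronglyMeasurable]
    have hX1 := gX.integral_abs i
    have hY1 := gY.integral_abs i
    rw [integral_map hX.aemeasurable (habs i).aestronglyMeasurable] at hX1
    rw [integral_map hY.aemeasurable (habs i).aestronglyMeasurable] at hY1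
    simp only [Pi.mul_apply, abs_mul]
    rw [(hind i).integral_fun_mul_eq_mul_integral (iX i).aestronglyMeasurable
      (iY i).aestronglyMeasurable, hX1, hY1, one_mul]

lemma measurable_prod_of_measurable {Zs : ℕ → Ω → Fin d → ℝ} (hm : ∀ n, Measurable (Zs n))
    (s : Finset ℕ) : Measurable (∏ m ∈ s, Zs m) :=
  Finset.prod_induction _ Measurable (fun _ _ => Measurable.mul) measurable_one fun m _ => hm m

lemma isGeneratorLaw_map_prod_range [IsProbabilityMeasure μ] {Zs : ℕ → Ω → Fin d → ℝ}
    (hm : ∀ n, Measurable (Zs n)) (hindep : iIndepFun Zs μ)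
    (hgen : ∀ n, IsGeneratorLaw (μ.map (Zs n))) (n : ℕ) :
    IsGeneratorLaw (μ.map (∏ m ∈ Finset.range n, Zs m)) := by
  induction n with
  | zero =>
    exact isGeneratorLaw_map (by simpa using measurable_one) (by simp) (by simp) (by simp)
  | succ n ih =>
    rw [Finset.prod_range_succ]
    exact isGeneratorLaw_map_mul (measurable_prod_of_measurable hm _) (hm n)
      (hindep.indepFun_prod_range_succ hm n) ih (hgen n)

lemma mulAverage_map_prod_range_succ [IsProbabilityMeasure μ] {Zs : ℕ → Ω → Fin d → ℝ}
    (hm : ∀ n, Measurable (Zs n)) (hindep : iIndepFun Zs μ)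
    (hgen : ∀ n, IsGeneratorLaw (μ.map (Zs n))) (hh : IsSumDominated h) (n : ℕ) :
    mulAverage (μ.map (∏ m ∈ Finset.range (n + 1), Zs m)) h =
      mulAverage (μ.map (Zs n)) (mulAverage (μ.map (∏ m ∈ Finset.range n, Zs m)) h) := by
  rw [Finset.prod_range_succ, mul_comm]
  exact hh.mulAverage_map_mul (hm n) (measurable_prod_of_measurable hm _)
    (hindep.indepFun_prod_range_succ hm n).symm (hgen n)
    (isGeneratorLaw_map_prod_range hm hindep hgen n)

lemma mulAverage_map_iSup_abs (hX : Measurable X) (hnn : ∀ i, ∀ᵐ ω ∂μ, 0 ≤ X ω i)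
    (x : Fin d → ℝ) :
    mulAverage (μ.map X) (fun y => ⨆ i, |y i|) x = ∫ ω, ⨆ i, |x i| * X ω i ∂μ := by
  rw [mulAverage_map hX isSumDominated_iSup_abs.measurable]
  refine integral_congr_ae ((ae_all_iff.2 hnn).mono fun ω hω => ?_)
  simp [abs_mul, abs_of_nonneg (hω _)]

end

/-- The limit of the track of powers of a fixed D-norm is idempotent. -/
theorem track_limit_is_idempotent {d : ℕ} (hd : 0 < d)
    {Ω : Type*} [MeasurableSpace Ω] (μ : Measure Ω) [IsProbabilityMeasure μ]
    (Z : Ω → Fin d → ℝ) (hZm : Measurable Z)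
    (hZnn : ∀ i, ∀ᵐ ω ∂μ, 0 ≤ Z ω i)
    (hZint : ∀ i, Integrable (fun ω => Z ω i) μ)
    (hZmean : ∀ i, ∫ ω, Z ω i ∂μ = 1)
    (Zs : ℕ → Ω → Fin d → ℝ) (hZsm : ∀ n, Measurable (Zs n))
    (hZsindep : iIndepFun Zs μ)
    (hcopies : ∀ n, μ.map (Zs n) = μ.map Z)
    (F : (Fin d → ℝ) → ℝ)
    (hF : ∀ x : Fin d → ℝ,
      Tendsto (fun n => ∫ ω, ⨆ i, |x i| * ∏ m ∈ Finset.range n, Zs m ω i ∂μ)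
        atTop (nhds (F x)))
    (Zstar Zstar' : Ω → Fin d → ℝ)
    (hZstarm : Measurable Zstar) (hZstar'm : Measurable Zstar')
    (hZstarnn : ∀ i, ∀ᵐ ω ∂μ, 0 ≤ Zstar ω i)
    (hZstar'nn : ∀ i, ∀ᵐ ω ∂μ, 0 ≤ Zstar' ω i)
    (hZstarint : ∀ i, Integrable (fun ω => Zstar ω i) μ)
    (hZstar'int : ∀ i, Integrable (fun ω => Zstar' ω i) μ)
    (hZstarmean : ∀ i, ∫ ω, Zstar ω i ∂μ = 1)
    (hZstar'mean : ∀ i, ∫ ω, Zstar' ω i ∂μ = 1)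
    (hstarindep : IndepFun Zstar Zstar' μ)
    (hstarid : μ.map Zstar' = μ.map Zstar)
    (hstar_seq_indep :
      IndepFun (fun ω => (Zstar ω, Zstar' ω)) (fun ω => fun n => Zs n ω) μ)
    (hZstargen : ∀ x : Fin d → ℝ, (∫ ω, ⨆ i, |x i| * Zstar ω i ∂μ) = F x) :
    ∀ x : Fin d → ℝ,
      (∫ ω, ⨆ i, |x i| * (Zstar ω i * Zstar' ω i) ∂μ) = F x := by
  have gZ : IsGeneratorLaw (μ.map Z) := isGeneratorLaw_map hZm hZnn hZint hZmean
  have gS : IsGeneratorLaw (μ.map Zstar) :=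
    isGeneratorLaw_map hZstarm hZstarnn hZstarint hZstarmean
  have gZs (n : ℕ) : IsGeneratorLaw (μ.map (Zs n)) := by rw [hcopies n]; exact gZ
  have hnn (n : ℕ) (i : Fin d) : ∀ᵐ ω ∂μ, 0 ≤ Zs n ω i := by
    have hs : MeasurableSet {y : Fin d → ℝ | 0 ≤ y i} :=
      measurableSet_le measurable_const (measurable_pi_apply i)
    have h1 : ∀ᵐ y ∂(μ.map Z), 0 ≤ y i := (ae_map_iff hZm.aemeasurable hs).2 (hZnn i)
    rw [← hcopies n] at h1
    exact (ae_map_iff (hZsm n).aemeasurable hs).1 h1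
  have hPm (n : ℕ) : Measurable (∏ m ∈ Finset.range n, Zs m) :=
    measurable_prod_of_measurable hZsm _
  have hPnn (n : ℕ) (i : Fin d) : ∀ᵐ ω ∂μ, 0 ≤ (∏ m ∈ Finset.range n, Zs m) ω i := by
    filter_upwards [ae_all_iff.2 fun m => hnn m i] with ω hω
    simpa using Finset.prod_nonneg fun m _ => hω m
  set L : (Fin d → ℝ) → ℝ := fun y => ⨆ i, |y i| with hL
  have dL : IsSumDominated L := isSumDominated_iSup_abs
  set G : ℕ → (Fin d → ℝ) → ℝ :=
    fun n => mulAverage (μ.map (∏ m ∈ Finset.range n, Zs m)) L with hG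
  have dG (n : ℕ) : IsSumDominated (G n) :=
    dL.mulAverage (isGeneratorLaw_map_prod_range hZsm hZsindep gZs n)
  have hGF (x : Fin d → ℝ) : Tendsto (fun n => G n x) atTop (nhds (F x)) := by
    refine (hF x).congr fun n => ?_
    simp only [hG, hL, mulAverage_map_iSup_abs (hPm n) (hPnn n), Finset.prod_apply]
  have hGsucc (n : ℕ) : G (n + 1) = mulAverage (μ.map Z) (G n) := by
    rw [← hcopies n]
    exact mulAverage_map_prod_range_succ hZsm hZsindep gZs dL n
  have hSL : mulAverage (μ.map Zstar) L = F := by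
    ext x
    rw [mulAverage_map_iSup_abs hZstarm hZstarnn, hZstargen]
  have hTF : mulAverage (μ.map Z) F = F := by
    ext x
    refine tendsto_nhds_unique (tendsto_mulAverage dG hGF gZ x) ?_
    simp only [← hGsucc]
    exact (hGF x).comp (tendsto_add_atTop_nat 1)
  have hSG (n : ℕ) : mulAverage (μ.map Zstar) (G n) = F := by
    induction n with
    | zero =>
      have h0 : G 0 = L := by
        ext x
        simp only [hG, mulAverage_map (hPm 0) dL.measurable]
        simp
      rw [h0, hSL]
    | succ n ih => rw [hGsucc, (dG n).mulAverage_comm gS gZ, ih, hTF]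
  have hSF : mulAverage (μ.map Zstar) F = F := by
    ext x
    refine tendsto_nhds_unique (tendsto_mulAverage dG hGF gS x) ?_
    simp only [hSG]
    exact tendsto_const_nhds
  intro x
  have hprod : mulAverage (μ.map (Zstar * Zstar')) L = F := by
    rw [dL.mulAverage_map_mul hZstarm hZstar'm hstarindep gS (by rw [hstarid]; exact gS),
      hstarid, hSL, hSF]
  rw [← hprod, mulAverage_map_iSup_abs (hZstarm.mul hZstar'm)]
  · rfl
  · intro i
    filter_upwards [hZstarnn i, hZstar'nn i] with ω h1 h2 using mul_nonneg h1 h2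
end
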